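/- arXiv:2501.17197 — 3 statements merged into one kernel-verified Lean document; each statement's English description precedes it below -/
import Mathlib

section
/- Let p be a prime, F = 𝔽_p, F̄ an algebraic closure of F, and G a finite group. Let Y be a finite-dimensional indecomposable F̄G-module. Suppose that for i = 1, 2 there are a finite subfield K_i of F̄, an indecomposable FG-module W_i, and an indecomposable K_iG-module V_i with V_i | W_i ⊗_F K_i and V_i ⊗_{K_i} F̄ ≅ Y. Then W_1 ≅ W_2 as FG-modules. (This is the well-definedness of the map Γ : ITI(F̄G) → ITI(FG).) -/
set_option synthInstance.maxHeartbeats 1600000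
set_option maxHeartbeats 1600000

open TensorProduct

/-- Base change of a representation along a (commutative) algebra `k → L`:
the `L`-linear representation of `G` on `V ⊗_k L = L ⊗[k] V`. -/
noncomputable def repBaseChange {k : Type*} [CommRing k] (L : Type*) [CommRing L] [Algebra k L]
    {G : Type*} [Monoid G] {V : Type*} [AddCommGroup V] [Module k V]
    (ρ : Representation k G V) : Representation L G (L ⊗[k] V) :=
  (Module.End.baseChangeHom k L V).toRingHom.toMonoidHom.comp ρ

/-- Restriction of scalars `Res_K` of a representation along `K ⊆ L`. -/
def repRes (K : Type*) {L : Type*} [CommRing K] [CommRing L] [Algebra K L]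
    {G : Type*} [Monoid G] {U : Type*} [AddCommGroup U] [Module K U] [Module L U]
    [IsScalarTower K L U] (ρ : Representation L G U) : Representation K G U where
  toFun g := (ρ g).restrictScalars K
  map_one' := by ext u; simp
  map_mul' g h := by ext u; simp

/-- Two representations of `G` over `k` are isomorphic iff the corresponding modules over the
group algebra `MonoidAlgebra k G` are linearly equivalent. -/
def RepIso {k : Type*} [CommSemiring k] {G : Type*} [Monoid G]
    {V W : Type*} [AddCommMonoid V] [Module k V] [AddCommMonoid W] [Module k W]
    (ρ : Representation k G V) (τ : Representation k G W) : Prop :=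
  Nonempty (ρ.asModule ≃ₗ[MonoidAlgebra k G] τ.asModule)

/-- `ρ | τ` : `ρ` is (isomorphic to) a direct summand of `τ`, i.e. `τ` is the internal direct
sum of two submodules (over the group algebra `MonoidAlgebra k G`), the first of which is
isomorphic to `ρ`. -/
def RepSummand {k : Type*} [CommSemiring k] {G : Type*} [Monoid G]
    {V W : Type*} [AddCommMonoid V] [Module k V] [AddCommMonoid W] [Module k W]
    (ρ : Representation k G V) (τ : Representation k G W) : Prop :=
  ∃ A B : Submodule (MonoidAlgebra k G) τ.asModule,
    IsCompl A B ∧ Nonempty (ρ.asModule ≃ₗ[MonoidAlgebra k G] A)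

/-- A representation is indecomposable if it is nonzero and the corresponding module over the
group algebra is not the internal direct sum of two nonzero submodules. -/
def RepIndecomposable {k : Type*} [CommSemiring k] {G : Type*} [Monoid G]
    {V : Type*} [AddCommMonoid V] [Module k V] (ρ : Representation k G V) : Prop :=
  Nontrivial V ∧
    ∀ A B : Submodule (MonoidAlgebra k G) ρ.asModule, IsCompl A B → A = ⊥ ∨ B = ⊥

/-- A representation is simple if the corresponding module over the group algebra is simple. -/
def RepSimple {k : Type*} [CommRing k] {G : Type*} [Monoid G]
    {V : Type*} [AddCommGroup V] [Module k V] (ρ : Representation k G V) : Prop :=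
  IsSimpleModule (MonoidAlgebra k G) ρ.asModule

namespace LinearMap

variable {R M N : Type*} [Ring R] [AddCommGroup M] [Module R M] [AddCommGroup N] [Module R N]

/-- An endomorphism of an indecomposable module of finite length is a unit or nilpotent. -/
theorem isNilpotent_of_not_isUnit_of_indecomposable [IsNoetherian R M] [IsArtinian R M]
    (hM : ∀ A B : Submodule R M, IsCompl A B → A = ⊥ ∨ B = ⊥)
    {f : Module.End R M} (hf : ¬ IsUnit f) : IsNilpotent f := by
  obtain ⟨n, hn, hn0⟩ :=
    (f.eventually_isCompl_ker_pow_range_pow.and (Filter.eventually_ne_atTop 0)).exists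
  rcases hM _ _ hn with h | h
  · refine absurd ?_ hf
    rw [← isUnit_pow_iff hn0, Module.End.isUnit_iff]
    exact IsArtinian.bijective_of_injective_endomorphism _ (LinearMap.ker_eq_bot.mp h)
  · exact ⟨n, LinearMap.range_eq_bot.mp h⟩

/-- The non-units of the endomorphism ring of an indecomposable module of finite length lie in
the Jacobson radical. -/
theorem mem_jacobson_of_not_isUnit_of_indecomposable [IsNoetherian R M] [IsArtinian R M]
    (hM : ∀ A B : Submodule R M, IsCompl A B → A = ⊥ ∨ B = ⊥)
    {f : Module.End R M} (hf : ¬ IsUnit f) : f ∈ Ring.jacobson (Module.End R M) := by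
  rw [← Ideal.jacobson_bot, Ideal.mem_jacobson_iff]
  intro g
  have hgf : ¬ IsUnit (g * f) := fun h ↦ hf <| by
    rw [Module.End.isUnit_iff] at h ⊢
    exact IsArtinian.bijective_of_injective_endomorphism _ (Function.Injective.of_comp h.1)
  obtain ⟨u, hu⟩ := (isNilpotent_of_not_isUnit_of_indecomposable hM hgf).isUnit_add_one
  refine ⟨↑u⁻¹, ?_⟩
  have : (↑u⁻¹ : Module.End R M) * g * f + ↑u⁻¹ = ↑u⁻¹ * ↑u := by rw [hu]; noncomm_ring
  simp [this]

/-- If a nonzero module has an automorphism factoring through an indecomposable module, then the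
two modules are isomorphic. -/
theorem nonempty_equiv_of_isUnit_comp [Nontrivial M]
    (hN : ∀ A B : Submodule R N, IsCompl A B → A = ⊥ ∨ B = ⊥)
    (a : M →ₗ[R] N) (b : N →ₗ[R] M) (h : IsUnit (b ∘ₗ a : Module.End R M)) :
    Nonempty (M ≃ₗ[R] N) := by
  obtain ⟨u, hu⟩ := h
  have hu_left (x : M) : (↑u⁻¹ : Module.End R M) (b (a x)) = x := by
    change ((↑u⁻¹ : Module.End R M) * (b ∘ₗ a : Module.End R M)) x = x
    rw [← hu, Units.inv_mul, Module.End.one_apply]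
  have hb : Function.Surjective b := fun x ↦ by
    refine ⟨a ((↑u⁻¹ : Module.End R M) x), ?_⟩
    change ((b ∘ₗ a : Module.End R M) * (↑u⁻¹ : Module.End R M)) x = x
    rw [← hu, Units.mul_inv, Module.End.one_apply]
  let c : N →ₗ[R] M := (↑u⁻¹ : Module.End R M) ∘ₗ b
  have hc : IsCompl (range a) (ker (a.rangeRestrict ∘ₗ c)) := by
    refine isCompl_of_proj ?_
    rintro ⟨_, x, rfl⟩
    exact Subtype.ext (congrArg a (hu_left x))
  rcases hN _ _ hc with h | h
  · obtain ⟨x, hx⟩ := exists_ne (0 : M)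
    refine absurd ?_ hx
    rw [← hu_left x, range_eq_bot.mp h]
    simp
  · refine ⟨(LinearEquiv.ofBijective b ⟨?_, hb⟩).symm⟩
    rw [← ker_eq_bot, eq_bot_iff, ← h]
    intro y hy
    have hy : b y = 0 := hy
    simp [c, hy]

end LinearMap

section Retract

variable {k G V W U : Type*} [CommRing k] [Monoid G] [AddCommGroup V] [AddCommGroup W]
  [AddCommGroup U] [Module k V] [Module k W] [Module k U]

/-- `ρ` is a retract of `τ`: the identity of `ρ` factors through `τ`. -/
def RepRetract (ρ : Representation k G V) (τ : Representation k G W) : Prop :=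
  ∃ (i : ρ.IntertwiningMap τ) (q : τ.IntertwiningMap ρ), ∀ v, q (i v) = v

variable {ρ : Representation k G V} {τ : Representation k G W} {σ : Representation k G U}

theorem RepRetract.trans (h₁ : RepRetract ρ τ) (h₂ : RepRetract τ σ) : RepRetract ρ σ := by
  obtain ⟨i, q, h⟩ := h₁
  obtain ⟨j, r, h'⟩ := h₂
  exact ⟨j.comp i, q.comp r, fun v ↦ by simp [h, h']⟩

theorem RepRetract.of_asModule (i : ρ.asModule →ₗ[MonoidAlgebra k G] τ.asModule)
    (q : τ.asModule →ₗ[MonoidAlgebra k G] ρ.asModule) (h : ∀ v, q (i v) = v) :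
    RepRetract ρ τ :=
  ⟨(Representation.IntertwiningMap.equivLinearMapAsModule ρ τ).symm i,
    (Representation.IntertwiningMap.equivLinearMapAsModule τ ρ).symm q, h⟩

theorem RepIso.retract_symm (h : RepIso ρ τ) : RepRetract τ ρ := by
  obtain ⟨e⟩ := h
  exact .of_asModule e.symm.toLinearMap e.toLinearMap e.apply_symm_apply

theorem RepSummand.retract (h : RepSummand ρ τ) : RepRetract ρ τ := by
  obtain ⟨A, B, hAB, ⟨e⟩⟩ := h
  refine .of_asModule (A.subtype ∘ₗ e.toLinearMap)
    (e.symm.toLinearMap ∘ₗ A.projectionOnto B hAB) fun v ↦ ?_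
  simp

@[simp]
theorem repBaseChange_apply_tmul (L : Type*) [CommRing L] [Algebra k L]
    (ρ : Representation k G V) (g : G) (l : L) (v : V) :
    repBaseChange L ρ g (l ⊗ₜ[k] v) = l ⊗ₜ[k] ρ g v := rfl

/-- Base change of an intertwining map. -/
noncomputable def Representation.IntertwiningMap.repBaseChange (L : Type*) [CommRing L]
    [Algebra k L] (f : ρ.IntertwiningMap τ) :
    (repBaseChange L ρ).IntertwiningMap (repBaseChange L τ) where
  toLinearMap := f.toLinearMap.baseChange L
  isIntertwining' g := by
    ext v
    simp [f.isIntertwining]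

theorem RepRetract.repBaseChange (L : Type*) [CommRing L] [Algebra k L] (h : RepRetract ρ τ) :
    RepRetract (repBaseChange L ρ) (repBaseChange L τ) := by
  obtain ⟨i, q, h⟩ := h
  refine ⟨i.repBaseChange L, q.repBaseChange L, fun v ↦ ?_⟩
  change (q.toLinearMap.baseChange L) (i.toLinearMap.baseChange L v) = v
  rw [← LinearMap.comp_apply, ← LinearMap.baseChange_comp,
    show q.toLinearMap ∘ₗ i.toLinearMap = LinearMap.id from LinearMap.ext h]
  simp

theorem RepRetract.repBaseChange_repBaseChange (K L : Type*) [CommRing K] [Algebra k K]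
    [CommRing L] [Algebra k L] [Algebra K L] [IsScalarTower k K L]
    (ρ : Representation k G V) :
    RepRetract (_root_.repBaseChange L (_root_.repBaseChange K ρ)) (_root_.repBaseChange L ρ) := by
  let e := AlgebraTensorModule.cancelBaseChange k K L L V
  refine ⟨⟨e.toLinearMap, fun g ↦ ?_⟩, ⟨e.symm.toLinearMap, fun g ↦ ?_⟩, e.symm_apply_apply⟩
  · ext v
    simp [e]
  · ext v
    simp [e]

end Retract

section Coordinates

variable {k G V W L ι : Type*} [CommRing k] [Monoid G] [AddCommGroup V] [AddCommGroup W]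
  [Module k V] [Module k W] [CommRing L] [Algebra k L]
  {ρ : Representation k G V} {σ : Representation k G W}

/-- The coordinates, with respect to a basis of `L` over `k`, of an intertwining map between
representations extended from `k` to `L`. -/
noncomputable def repCoord (ℬ : Module.Basis ι k L)
    (α : (repBaseChange L ρ).IntertwiningMap (repBaseChange L σ)) (i : ι) :
    ρ.IntertwiningMap σ where
  toLinearMap := (TensorProduct.lid k W).toLinearMap ∘ₗ (ℬ.coord i).rTensor W ∘ₗ
    α.toLinearMap.restrictScalars k ∘ₗ TensorProduct.mk k L V 1
  isIntertwining' g := by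
    have key (x : L ⊗[k] W) : TensorProduct.lid k W ((ℬ.coord i).rTensor W (repBaseChange L σ g x))
        = σ g (TensorProduct.lid k W ((ℬ.coord i).rTensor W x)) := by
      induction x with
      | zero => simp
      | tmul l w => simp
      | add x y hx hy => simp only [map_add, hx, hy]
    ext v
    have := α.isIntertwining _ _ g (1 ⊗ₜ[k] v)
    rw [repBaseChange_apply_tmul] at this
    simp [this, key]

theorem exists_apply_one_tmul_eq_sum_repCoord (ℬ : Module.Basis ι k L)
    (α : (repBaseChange L ρ).IntertwiningMap (repBaseChange L σ)) (v : V) :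
    ∃ s : Finset ι, α (1 ⊗ₜ[k] v) = ∑ i ∈ s, ℬ i • ((1 : L) ⊗ₜ[k] repCoord ℬ α i v) := by
  classical
  let c := TensorProduct.equivFinsuppOfBasisLeft (N := W) ℬ (α (1 ⊗ₜ[k] v))
  refine ⟨c.support, ?_⟩
  have h : (TensorProduct.equivFinsuppOfBasisLeft (N := W) ℬ).symm c = α (1 ⊗ₜ[k] v) :=
    LinearEquiv.symm_apply_apply _ _
  rw [← h, TensorProduct.equivFinsuppOfBasisLeft_symm_apply, Finsupp.sum]
  refine Finset.sum_congr rfl fun i _ ↦ ?_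
  rw [TensorProduct.smul_tmul', smul_eq_mul, mul_one]
  congr 1
  exact TensorProduct.equivFinsuppOfBasisLeft_apply ..

end Coordinates

section CommonRetract

variable {k G V W L U : Type*} [Field k] [Monoid G] [AddCommGroup V] [AddCommGroup W]
  [AddCommGroup U] [Module k V] [Module k W] [CommRing L] [Algebra k L] [Module L U]
  {ρ : Representation k G V} {σ : Representation k G W} {υ : Representation L G U}

/-- If every composite `ρ → σ → ρ` lies in a two-sided ideal `J` of the endomorphism ring, then the
`n`-th power of a composite of intertwining maps between the scalar extensions has image in the
extension of `J ^ n` applied to `ρ`. -/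
theorem iterate_comp_mem_span (J : Ideal (Module.End (MonoidAlgebra k G) ρ.asModule))
    [J.IsTwoSided]
    (hJ : ∀ (a : ρ.IntertwiningMap σ) (b : σ.IntertwiningMap ρ),
      Representation.IntertwiningMap.equivLinearMapAsModule ρ ρ (b.comp a) ∈ J)
    (α : (repBaseChange L ρ).IntertwiningMap (repBaseChange L σ))
    (β : (repBaseChange L σ).IntertwiningMap (repBaseChange L ρ)) (n : ℕ) (x : L ⊗[k] V) :
    (fun y ↦ β (α y))^[n] x ∈ Submodule.span L
      {y | ∃ f ∈ J ^ n, ∃ v : V,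
        y = 1 ⊗ₜ[k] ρ.asModuleEquiv (f (ρ.asModuleEquiv.symm v))} := by
  induction n with
  | zero =>
    induction x with
    | zero => exact zero_mem _
    | tmul l v =>
      have : l ⊗ₜ[k] v = l • ((1 : L) ⊗ₜ[k] v) := by simp [TensorProduct.smul_tmul']
      simp only [Function.iterate_zero, id]
      rw [this]
      exact Submodule.smul_mem _ _
        (Submodule.subset_span ⟨1, by simp [Submodule.pow_zero], v, rfl⟩)
    | add x y hx hy => exact add_mem hx hy
  | succ n ih =>
    rw [Function.iterate_succ_apply']
    generalize (fun y ↦ β (α y))^[n] x = z at ih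
    induction ih using Submodule.span_induction with
    | zero => simp
    | add y z _ _ hy hz => simpa using add_mem hy hz
    | smul l y _ hy => simpa using Submodule.smul_mem _ l hy
    | mem y hy =>
      obtain ⟨f, hf, v, rfl⟩ := hy
      let ℬ := Module.Basis.ofVectorSpace k L
      obtain ⟨s, hs⟩ := exists_apply_one_tmul_eq_sum_repCoord ℬ α
        (ρ.asModuleEquiv (f (ρ.asModuleEquiv.symm v)))
      simp only [hs, map_sum, map_smul]
      refine sum_mem fun i _ ↦ Submodule.smul_mem _ _ ?_
      obtain ⟨t, ht⟩ := exists_apply_one_tmul_eq_sum_repCoord ℬ β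
        (repCoord ℬ α i (ρ.asModuleEquiv (f (ρ.asModuleEquiv.symm v))))
      rw [ht]
      refine sum_mem fun j _ ↦ Submodule.smul_mem _ _ (Submodule.subset_span ?_)
      have hmul := Ideal.mul_mem_mul (hJ (repCoord ℬ α i) (repCoord ℬ β j)) hf
      rw [← Ideal.IsTwoSided.pow_succ] at hmul
      exact ⟨_, hmul, v, rfl⟩

/-- If the extensions to `L` of two indecomposable finite-dimensional representations over `k`
have a common nonzero retract, then they are isomorphic. -/
theorem repIso_of_common_retract [Module.Finite k V] [Nontrivial U]
    (hρ : RepIndecomposable ρ) (hσ : RepIndecomposable σ)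
    (h₁ : RepRetract υ (repBaseChange L ρ)) (h₂ : RepRetract υ (repBaseChange L σ)) :
    RepIso ρ σ := by
  by_contra hne
  have : Nontrivial ρ.asModule := hρ.1
  have : IsNoetherian (MonoidAlgebra k G) ρ.asModule := isNoetherian_of_tower k inferInstance
  have : IsArtinian (MonoidAlgebra k G) ρ.asModule := isArtinian_of_tower k inferInstance
  have : Module.Finite k (Module.End (MonoidAlgebra k G) ρ.asModule) :=
    Module.Finite.of_injective
      (LinearMap.restrictScalarsₗ k (MonoidAlgebra k G) ρ.asModule ρ.asModule k)
      (LinearMap.restrictScalars_injective k)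
  have : IsArtinianRing (Module.End (MonoidAlgebra k G) ρ.asModule) :=
    IsArtinianRing.of_finite k _
  obtain ⟨n, hn⟩ := IsSemiprimaryRing.isNilpotent
    (R := Module.End (MonoidAlgebra k G) ρ.asModule)
  obtain ⟨i, q, hq⟩ := h₁
  obtain ⟨j, r, hr⟩ := h₂
  have hfix (u : U) : (i.comp r) ((j.comp q) (i u)) = i u := by simp [hq, hr]
  obtain ⟨u, hu⟩ := exists_ne (0 : U)
  have hmem := iterate_comp_mem_span (Ring.jacobson (Module.End (MonoidAlgebra k G) ρ.asModule))
    (fun a b ↦ LinearMap.mem_jacobson_of_not_isUnit_of_indecomposable hρ.2 fun h ↦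
      hne (LinearMap.nonempty_equiv_of_isUnit_comp hσ.2
        (Representation.IntertwiningMap.equivLinearMapAsModule ρ σ a)
        (Representation.IntertwiningMap.equivLinearMapAsModule σ ρ b) h))
    (j.comp q) (i.comp r) n (i u)
  rw [Function.iterate_fixed (hfix u), hn] at hmem
  have hbot : i u = 0 := by
    rw [← Submodule.mem_bot L]
    refine Submodule.span_le.mpr ?_ hmem
    rintro _ ⟨f, hf, v, rfl⟩
    rw [show f = 0 from hf]
    simp
  exact hu (by rw [← hq u, hbot, map_zero])

end CommonRetract

/-- Well-definedness of the map `Γ : ITI(F̄G) → ITI(FG)` : if a finite-dimensional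
indecomposable `F̄G`-module `Y` is the extension to `F̄` of components `V₁, V₂` (over finite
subfields `K₁, K₂` of `F̄`) of `W₁ ⊗_F K₁`, `W₂ ⊗_F K₂` for indecomposable `FG`-modules
`W₁, W₂`, then `W₁ ≅ W₂`. -/
theorem gamma_wellDefined (p : ℕ) [Fact p.Prime]
    (G : Type) [Group G] [Finite G]
    (Y : FDRep (AlgebraicClosure (ZMod p)) G) (hY : RepIndecomposable Y.ρ)
    (K₁ K₂ : IntermediateField (ZMod p) (AlgebraicClosure (ZMod p)))
    (hK₁ : Finite ↥K₁) (hK₂ : Finite ↥K₂)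
    (W₁ W₂ : FDRep (ZMod p) G)
    (hW₁ : RepIndecomposable W₁.ρ) (hW₂ : RepIndecomposable W₂.ρ)
    (V₁ : FDRep ↥K₁ G) (V₂ : FDRep ↥K₂ G)
    (hV₁ : RepIndecomposable V₁.ρ) (hV₂ : RepIndecomposable V₂.ρ)
    (hVW₁ : RepSummand V₁.ρ (repBaseChange ↥K₁ W₁.ρ))
    (hVW₂ : RepSummand V₂.ρ (repBaseChange ↥K₂ W₂.ρ))
    (hY₁ : RepIso (repBaseChange (AlgebraicClosure (ZMod p)) V₁.ρ) Y.ρ)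
    (hY₂ : RepIso (repBaseChange (AlgebraicClosure (ZMod p)) V₂.ρ) Y.ρ) :
    RepIso W₁.ρ W₂.ρ := by
  have := hY.1
  exact repIso_of_common_retract hW₁ hW₂
    ((hY₁.retract_symm.trans (hVW₁.retract.repBaseChange _)).trans
      (.repBaseChange_repBaseChange ↥K₁ _ W₁.ρ))
    ((hY₂.retract_symm.trans (hVW₂.retract.repBaseChange _)).trans
      (.repBaseChange_repBaseChange ↥K₂ _ W₂.ρ))
end

section
/- Let p be a prime, F = 𝔽_p, F̄ an algebraic closure of F, and G a finite group. For every indecomposable FG-module W there exist a finite subfield K of F̄, an indecomposable KG-module V with V | W ⊗_F K, and a finite-dimensional indecomposable F̄G-module Y such that V ⊗_K F̄ ≅ Y. (This is the nonemptiness of each fiber Γ⁻¹(W) of the map Γ : ITI(F̄G) → ITI(FG).) -/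
set_option synthInstance.maxHeartbeats 1600000
set_option maxHeartbeats 1600000

open TensorProduct

universe u

/-- A nonzero representation all of whose equivariant idempotents are trivial is
indecomposable. -/
theorem repIndecomposable_of_forall_idempotent {k G V : Type*} [CommRing k] [Monoid G]
    [AddCommGroup V] [Module k V] [Nontrivial V] (ρ : Representation k G V)
    (h : ∀ f : Module.End k V, IsIdempotentElem f → (∀ g, Commute f (ρ g)) → f = 0 ∨ f = 1) :
    RepIndecomposable ρ := by
  refine ⟨inferInstance, fun A B hAB => ?_⟩
  let q : Module.End (MonoidAlgebra k G) ρ.asModule := A.projection B hAB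
  let f : Representation.IntertwiningMap ρ ρ :=
    (Representation.IntertwiningMap.equivLinearMapAsModule ρ ρ).symm q
  have hidem : IsIdempotentElem f.toLinearMap := by
    ext x
    exact congr($(Submodule.isIdempotentElem_projection hAB) x)
  rcases h f.toLinearMap hidem f.isIntertwining' with h0 | h1
  · left
    rw [eq_bot_iff]
    intro x hx
    have hx' : q x = x := Submodule.projection_apply_of_mem_left hAB hx
    rw [Submodule.mem_bot, ← hx']
    exact congr($h0 x)
  · right
    rw [eq_bot_iff]
    intro x hx
    have hx' : q x = 0 := (Submodule.projection_apply_eq_zero_iff hAB).2 hx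
    rw [Submodule.mem_bot, ← hx']
    exact congr($h1.symm x)

/-- An equivariantly split injection exhibits its source as a direct summand of its target. -/
theorem repSummand_of_leftInverse {k G V W : Type*} [CommRing k] [Monoid G]
    [AddCommGroup V] [Module k V] [AddCommGroup W] [Module k W]
    {ρ : Representation k G V} {τ : Representation k G W}
    (i : Representation.IntertwiningMap ρ τ) (r : Representation.IntertwiningMap τ ρ)
    (h : Function.LeftInverse r i) : RepSummand ρ τ := by
  let i' := Representation.IntertwiningMap.equivLinearMapAsModule ρ τ i
  let r' := Representation.IntertwiningMap.equivLinearMapAsModule τ ρ r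
  have h' : Function.LeftInverse r' i' := h
  refine ⟨LinearMap.range i', LinearMap.ker r', ⟨?_, ?_⟩,
    ⟨LinearEquiv.ofInjective i' h'.injective⟩⟩
  · rw [Submodule.disjoint_def]
    rintro _ ⟨y, rfl⟩ hy
    rw [LinearMap.mem_ker, h' y] at hy
    rw [hy, map_zero]
  · rw [codisjoint_iff, eq_top_iff]
    intro x _
    refine Submodule.mem_sup.2 ⟨i' (r' x), ⟨_, rfl⟩, x - i' (r' x), ?_, by abel⟩
    rw [LinearMap.mem_ker, map_sub, h' (r' x), sub_self]

/-- On a nonzero finite-dimensional representation there is a primitive equivariant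
idempotent. -/
theorem exists_primitive_equivariant_idempotent {k G V : Type*} [Field k] [Monoid G]
    [AddCommGroup V] [Module k V] [FiniteDimensional k V] [Nontrivial V]
    (ρ : Representation k G V) :
    ∃ e : Module.End k V, e ≠ 0 ∧ IsIdempotentElem e ∧ (∀ g, Commute e (ρ g)) ∧
      ∀ f : Module.End k V, IsIdempotentElem f → (∀ g, Commute f (ρ g)) →
        e * f = f → f * e = f → f = 0 ∨ f = e := by
  let S : Set (Module.End k V) := {e | e ≠ 0 ∧ IsIdempotentElem e ∧ ∀ g, Commute e (ρ g)}
  have hS : S.Nonempty := ⟨1, one_ne_zero, IsIdempotentElem.one, fun g => Commute.one_left _⟩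
  let d : Module.End k V → ℕ := fun e => Module.finrank k (LinearMap.range e)
  obtain ⟨he0, heI, heG⟩ := Function.argminOn_mem d S hS
  refine ⟨Function.argminOn d S hS, he0, heI, heG, fun f hfI hfG hef hfe => ?_⟩
  by_cases hf0 : f = 0
  · exact Or.inl hf0
  right
  have hmin := Function.argminOn_le d S (a := f) ⟨hf0, hfI, hfG⟩
  set e := Function.argminOn d S hS
  have hle : LinearMap.range f ≤ LinearMap.range e := by
    rw [← hef]
    exact LinearMap.range_comp_le_range f e
  have hrange := Submodule.eq_of_le_of_finrank_le hle hmin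
  rw [← hfe]
  ext x
  have hx : e x ∈ LinearMap.range f := hrange ▸ LinearMap.mem_range_self e x
  obtain ⟨y, hy⟩ := hx
  rw [Module.End.mul_apply, ← hy]
  exact congr($hfI y)

/-- Base change of linear maps from a field to a nontrivial algebra is injective. -/
theorem linearMap_baseChange_injective {k L V W : Type*} [Field k] [CommRing L] [Nontrivial L]
    [Algebra k L] [AddCommGroup V] [Module k V] [AddCommGroup W] [Module k W] :
    Function.Injective (LinearMap.baseChange L : (V →ₗ[k] W) → _) := by
  intro f g h
  ext x
  apply Module.FaithfullyFlat.tensorProduct_mk_injective (A := k) (B := L) W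
  simpa using congr($h (1 ⊗ₜ x))

/-- An endomorphism of `L ⊗ V` is defined over a finite intermediate field when the base field is
finite and `L` is algebraic over it. -/
theorem exists_finite_intermediateField_baseChange_eq {k L V : Type*} [Field k] [Finite k]
    [Field L] [Algebra k L] [Algebra.IsAlgebraic k L] [AddCommGroup V] [Module k V]
    [FiniteDimensional k V] (e : Module.End L (L ⊗[k] V)) :
    ∃ K : IntermediateField k L, Finite K ∧ ∃ e' : Module.End K (K ⊗[k] V),
      e ∘ₗ (AlgebraTensorModule.cancelBaseChange k K L L V).toLinearMap =
        (AlgebraTensorModule.cancelBaseChange k K L L V).toLinearMap ∘ₗ e'.baseChange L := by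
  let b := Module.finBasis k V
  let M := LinearMap.toMatrix (b.baseChange L) (b.baseChange L) e
  let K := IntermediateField.adjoin k (Set.range fun ij : _ × _ => M ij.1 ij.2)
  have hmem (i j) : M i j ∈ K := IntermediateField.subset_adjoin _ _ ⟨(i, j), rfl⟩
  have : FiniteDimensional k K :=
    IntermediateField.finiteDimensional_adjoin fun x _ =>
      (Algebra.IsAlgebraic.isAlgebraic x).isIntegral
  refine ⟨K, Module.finite_of_finite k, ?_⟩
  let M' : Matrix _ _ K := Matrix.of fun i j => (⟨M i j, hmem i j⟩ : K)
  refine ⟨Matrix.toLin (b.baseChange K) (b.baseChange K) M', ?_⟩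
  refine ((b.baseChange K).baseChange L).ext fun j => ?_
  have hj : e (1 ⊗ₜ b j) = ∑ i, M i j • (1 ⊗ₜ[k] b i : L ⊗[k] V) := by
    have := Matrix.toLin_self (b.baseChange L) (b.baseChange L) M j
    simpa [M, Matrix.toLin_toMatrix] using this
  have hj' := Matrix.toLin_self (b.baseChange K) (b.baseChange K) M' j
  simp only [Module.Basis.baseChange_apply] at hj'
  simp only [Module.Basis.baseChange_apply, LinearMap.comp_apply, LinearEquiv.coe_coe,
    AlgebraTensorModule.cancelBaseChange_tmul, one_smul, LinearMap.baseChange_tmul, hj, hj']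
  simp [TensorProduct.tmul_sum, TensorProduct.smul_tmul', M', IntermediateField.smul_def]

/-- If an intertwining split injection realises a primitive idempotent of the target, its source has
only trivial equivariant idempotents. -/
theorem idempotent_trivial_of_primitive {k G V W : Type*} [CommRing k] [Monoid G]
    [AddCommGroup V] [Module k V] [AddCommGroup W] [Module k W]
    {ρ : Representation k G V} {τ : Representation k G W} {e : Module.End k W}
    (he : ∀ f : Module.End k W, IsIdempotentElem f → (∀ g, Commute f (τ g)) →
        e * f = f → f * e = f → f = 0 ∨ f = e)
    (i : V →ₗ[k] W) (r : W →ₗ[k] V) (hi : ∀ g, i ∘ₗ ρ g = τ g ∘ₗ i)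
    (hr : ∀ g, r ∘ₗ τ g = ρ g ∘ₗ r) (hri : ∀ x, r (i x) = x) (hir : ∀ x, i (r x) = e x)
    (f : Module.End k V) (hfI : IsIdempotentElem f) (hfG : ∀ g, Commute f (ρ g)) :
    f = 0 ∨ f = 1 := by
  have hf (x) : f (f x) = f x := congr($hfI x)
  have hfg (g x) : f (ρ g x) = ρ g (f x) := congr($(hfG g) x)
  have hi' (g x) : i (ρ g x) = τ g (i x) := congr($(hi g) x)
  have hr' (g x) : r (τ g x) = ρ g (r x) := congr($(hr g) x)
  have key := he (i ∘ₗ f ∘ₗ r) (by ext x; simp [hri, hf])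
    (fun g => by ext x; simp [hr', hfg, hi']) (by ext x; simp [← hir, hri])
    (by ext x; simp [← hir, hri])
  refine key.imp (fun h => ?_) (fun h => ?_) <;> ext x
  · simpa [hri] using congr(r ($h (i x)))
  · simpa [hri, ← hir] using congr(r ($h (i x)))

/-- Equivariant idempotents split. -/
theorem exists_splitting_of_equivariant_idempotent {k G : Type*} {V : Type u} [Field k] [Monoid G]
    [AddCommGroup V] [Module k V] [FiniteDimensional k V] (τ : Representation k G V)
    (e : Module.End k V) (heI : e ∘ₗ e = e) (heG : ∀ g, e ∘ₗ τ g = τ g ∘ₗ e) :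
    ∃ (R : Type u) (_ : AddCommGroup R) (_ : Module k R) (_ : FiniteDimensional k R)
      (σ : Representation k G R) (i : R →ₗ[k] V) (r : V →ₗ[k] R),
      (∀ g, i ∘ₗ σ g = τ g ∘ₗ i) ∧ (∀ g, r ∘ₗ τ g = σ g ∘ₗ r) ∧ r ∘ₗ i = LinearMap.id ∧
        i ∘ₗ r = e := by
  have hI (x) : e (e x) = e x := congr($heI x)
  have hG (g x) : e (τ g x) = τ g (e x) := congr($(heG g) x)
  let i : LinearMap.range e →ₗ[k] V := (LinearMap.range e).subtype
  let r : V →ₗ[k] LinearMap.range e := e.rangeRestrict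
  have hir (x) : i (r x) = e x := rfl
  have hi : Function.Injective i := Subtype.val_injective
  have hri (x) : r (i x) = x := by
    obtain ⟨_, y, rfl⟩ := x
    exact hi (hI y)
  have hei (x) : e (i x) = i x := by rw [← hir, hri]
  let σ : Representation k G (LinearMap.range e) :=
    { toFun := fun g => r ∘ₗ τ g ∘ₗ i
      map_one' := by
        refine LinearMap.ext fun x => ?_
        simp [hri]
      map_mul' := fun g h => by
        refine LinearMap.ext fun x => hi ?_
        simp only [LinearMap.comp_apply, Module.End.mul_apply, hir, map_mul, hG, hei] }
  have hσ (g x) : σ g x = r (τ g (i x)) := rfl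
  refine ⟨LinearMap.range e, inferInstance, inferInstance, inferInstance, σ, i, r,
    fun g => LinearMap.ext fun x => ?_, fun g => LinearMap.ext fun x => hi ?_,
    LinearMap.ext hri, rfl⟩
  · simp only [LinearMap.comp_apply, hσ, hir, hG, hei]
  · simp only [LinearMap.comp_apply, hσ, hir, hG, hI]

/-- If all equivariant idempotents of the base change are trivial, so are those of the original
representation. -/
theorem idempotent_trivial_of_baseChange {k L G V : Type*} [Field k] [Field L] [Algebra k L]
    [Monoid G] [AddCommGroup V] [Module k V] (σ : Representation k G V)
    (h : ∀ f : Module.End L (L ⊗[k] V), IsIdempotentElem f →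
      (∀ g, Commute f (repBaseChange L σ g)) → f = 0 ∨ f = 1)
    (f : Module.End k V) (hfI : IsIdempotentElem f) (hfG : ∀ g, Commute f (σ g)) :
    f = 0 ∨ f = 1 := by
  have hinj := linearMap_baseChange_injective (k := k) (L := L) (V := V) (W := V)
  have hI : IsIdempotentElem (f.baseChange L) := by
    rw [IsIdempotentElem, ← LinearMap.baseChange_mul, hfI.eq]
  have hG (g) : Commute (f.baseChange L) (repBaseChange L σ g) := by
    change f.baseChange L * (σ g).baseChange L = (σ g).baseChange L * f.baseChange L
    rw [← LinearMap.baseChange_mul, ← LinearMap.baseChange_mul, (hfG g).eq]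
  refine (h _ hI hG).imp (fun h0 => hinj ?_) (fun h1 => hinj ?_)
  · rw [h0, LinearMap.baseChange_zero]
  · rw [h1, LinearMap.baseChange_one]

/-- Over a finite field, some indecomposable summand of a nonzero representation, after extending
scalars to a finite intermediate field of an algebraic extension `L`, stays indecomposable
over `L`. -/
theorem exists_summand_indecomposable_baseChange {k L V : Type u} {G : Type*}
    [Field k] [Finite k] [Field L] [Algebra k L] [Algebra.IsAlgebraic k L] [Monoid G] [AddCommGroup V]
    [Module k V] [FiniteDimensional k V] [Nontrivial V] (ρ : Representation k G V) :
    ∃ K : IntermediateField k L, Finite K ∧ ∃ (R : Type u) (_ : AddCommGroup R)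
      (_ : Module K R) (_ : FiniteDimensional K R) (σ : Representation K G R),
        RepIndecomposable σ ∧ RepSummand σ (repBaseChange K ρ) ∧
        RepIndecomposable (repBaseChange L σ) := by
  obtain ⟨e, he0, heI, heG, heP⟩ := exists_primitive_equivariant_idempotent (repBaseChange L ρ)
  obtain ⟨K, hK, e', hee'⟩ := exists_finite_intermediateField_baseChange_eq e
  let c := AlgebraTensorModule.cancelBaseChange k K L L V
  have hc (x) : e (c x) = c (e'.baseChange L x) := congr($hee' x)
  have hcG (g : G) (x : L ⊗[K] (K ⊗[k] V)) :
      c ((repBaseChange K ρ g).baseChange L x) = repBaseChange L ρ g (c x) := by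
    change c (((ρ g).baseChange K).baseChange L x) = (ρ g).baseChange L (c x)
    induction x with
    | zero => simp only [map_zero]
    | add x y hx hy => simp only [map_add, hx, hy]
    | tmul l y =>
      induction y with
      | zero => simp only [tmul_zero, map_zero]
      | add x y hx hy => simp only [tmul_add, map_add, hx, hy]
      | tmul a v => simp [c]
  have heI' (x) : e (e x) = e x := congr($heI x)
  have heG' (g x) : e (repBaseChange L ρ g x) = repBaseChange L ρ g (e x) := congr($(heG g) x)
  have hI' : e' ∘ₗ e' = e' := by
    apply linearMap_baseChange_injective (L := L)
    refine LinearMap.ext fun x => c.injective ?_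
    rw [LinearMap.baseChange_comp, LinearMap.comp_apply, ← hc, ← hc, heI']
  have hG' (g : G) : e' ∘ₗ repBaseChange K ρ g = repBaseChange K ρ g ∘ₗ e' := by
    apply linearMap_baseChange_injective (L := L)
    refine LinearMap.ext fun x => c.injective ?_
    rw [LinearMap.baseChange_comp, LinearMap.baseChange_comp, LinearMap.comp_apply,
      LinearMap.comp_apply, ← hc, hcG, hcG, ← hc, heG']
  obtain ⟨R, _, _, _, σ, i, r, hi, hr, hri, hir⟩ :=
    exists_splitting_of_equivariant_idempotent (repBaseChange K ρ) e' hI' hG'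
  have hL := idempotent_trivial_of_primitive (ρ := repBaseChange L σ) heP
    (c.toLinearMap ∘ₗ i.baseChange L) (r.baseChange L ∘ₗ c.symm.toLinearMap)
    (fun g => by
      refine LinearMap.ext fun x => ?_
      have := congr(($(hi g)).baseChange L x)
      rw [LinearMap.baseChange_comp, LinearMap.baseChange_comp] at this
      exact congr(c $this).trans (hcG g _))
    (fun g => by
      refine LinearMap.ext fun x => ?_
      obtain ⟨x, rfl⟩ := c.surjective x
      have := congr(($(hr g)).baseChange L x)
      rw [LinearMap.baseChange_comp, LinearMap.baseChange_comp] at this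
      simp only [LinearMap.comp_apply, LinearEquiv.coe_coe, ← hcG, c.symm_apply_apply]
      exact this)
    (fun x => by
      have := congr(($hri).baseChange L x)
      rw [LinearMap.baseChange_comp] at this
      simpa using this)
    (fun x => by
      obtain ⟨x, rfl⟩ := c.surjective x
      rw [hc, ← hir, LinearMap.baseChange_comp]
      simp)
  have hRn : Nontrivial R := by
    by_contra hR
    rw [not_nontrivial_iff_subsingleton] at hR
    have h0 : e' = 0 := by rw [← hir, Subsingleton.elim r 0, LinearMap.comp_zero]
    apply he0
    refine LinearMap.ext fun x => ?_
    obtain ⟨x, rfl⟩ := c.surjective x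
    simp [hc, h0]
  exact ⟨K, hK, R, _, _, ‹_›, σ,
    repIndecomposable_of_forall_idempotent σ (idempotent_trivial_of_baseChange σ hL),
    repSummand_of_leftInverse ⟨i, hi⟩ ⟨r, hr⟩ (LinearMap.congr_fun hri),
    repIndecomposable_of_forall_idempotent _ hL⟩

/-- Nonemptiness of the fibers of `Γ : ITI(F̄G) → ITI(FG)` : for every indecomposable
`FG`-module `W` there are a finite subfield `K` of `F̄`, an indecomposable `KG`-module `V` with
`V | W ⊗_F K`, and a finite-dimensional indecomposable `F̄G`-module `Y` with `V ⊗_K F̄ ≅ Y`. -/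
theorem gamma_fiber_nonempty (p : ℕ) [Fact p.Prime]
    (G : Type) [Group G] [Finite G]
    (W : FDRep (ZMod p) G) (hW : RepIndecomposable W.ρ) :
    ∃ K : IntermediateField (ZMod p) (AlgebraicClosure (ZMod p)), Finite ↥K ∧
      ∃ V : FDRep ↥K G, RepIndecomposable V.ρ ∧
        RepSummand V.ρ (repBaseChange ↥K W.ρ) ∧
        ∃ Y : FDRep (AlgebraicClosure (ZMod p)) G, RepIndecomposable Y.ρ ∧
          RepIso (repBaseChange (AlgebraicClosure (ZMod p)) V.ρ) Y.ρ := by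
  have : Nontrivial W := hW.1
  obtain ⟨K, hK, R, _, _, _, σ, hσ, hs, hL⟩ := exists_summand_indecomposable_baseChange
    (L := AlgebraicClosure (ZMod p)) W.ρ
  exact ⟨K, hK, FDRep.of σ, hσ, hs,
    FDRep.of (repBaseChange (AlgebraicClosure (ZMod p)) σ), hL, ⟨LinearEquiv.refl _ _⟩⟩
end

section
/- Let p be a prime, F = 𝔽_p, F̄ an algebraic closure of F, and G a finite group. Let X be a finite-dimensional simple F̄G-module. Then: (i) there exist a finite subfield K of F̄, a simple FG-module W, and a simple KG-module V with V | W ⊗_F K and V ⊗_K F̄ ≅ X; and (ii) if for i = 1, 2 there are finite subfields K_i of F̄, simple FG-modules W_i, and indecomposable K_iG-modules V_i with V_i | W_i ⊗_F K_i and V_i ⊗_{K_i} F̄ ≅ X, then W_1 ≅ W_2 as FG-modules. (This is the totality and well-definedness of the map Σ : ITS(F̄G) → ITS(FG).) -/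
set_option synthInstance.maxHeartbeats 1600000
set_option maxHeartbeats 1600000

open TensorProduct

open Representation (IntertwiningMap IsIrreducible)

section Dictionary

variable {k G V W : Type*} [Field k] [Monoid G] [AddCommGroup V] [Module k V]
  [AddCommGroup W] [Module k W] {ρ : Representation k G V} {τ : Representation k G W}

lemma repIso_iff : RepIso ρ τ ↔ Nonempty (ρ.Equiv τ) := by
  constructor
  · rintro ⟨e⟩
    exact ⟨((IntertwiningMap.equivLinearMapAsModule ρ τ).symm e.toLinearMap).ofBijective
      e.bijective⟩
  · rintro ⟨e⟩
    exact ⟨LinearEquiv.ofBijective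
      (IntertwiningMap.equivLinearMapAsModule ρ τ e.toIntertwiningMap) e.toLinearEquiv.bijective⟩

lemma repSimple_iff : RepSimple ρ ↔ IsIrreducible ρ :=
  (Representation.irreducible_iff_isSimpleModule_asModule ρ).symm

lemma repSummand_iff :
    RepSummand ρ τ ↔ ∃ (i : IntertwiningMap ρ τ) (r : IntertwiningMap τ ρ), ∀ v, r (i v) = v := by
  constructor
  · rintro ⟨A, B, h, ⟨e⟩⟩
    refine ⟨(IntertwiningMap.equivLinearMapAsModule ρ τ).symm (A.subtype ∘ₗ e.toLinearMap),
      (IntertwiningMap.equivLinearMapAsModule τ ρ).symm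
        (e.symm.toLinearMap ∘ₗ A.projectionOnto B h), fun v ↦ ?_⟩
    change e.symm (A.projectionOnto B h (e v)) = v
    rw [Submodule.projectionOnto_apply_left]
    exact e.symm_apply_apply v
  · rintro ⟨i, r, h⟩
    let i' := IntertwiningMap.equivLinearMapAsModule ρ τ i
    let r' := IntertwiningMap.equivLinearMapAsModule τ ρ r
    have h' : ∀ v, r' (i' v) = v := h
    refine ⟨LinearMap.range i', LinearMap.ker (i'.rangeRestrict ∘ₗ r'),
      LinearMap.isCompl_of_proj ?_,
      ⟨LinearEquiv.ofInjective i' (Function.LeftInverse.injective h')⟩⟩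
    rintro ⟨_, v, rfl⟩
    ext
    simp [h']

end Dictionary

section BaseChange

variable {k L G V W : Type*} [Field k] [Field L] [Algebra k L] [Monoid G]
  [AddCommGroup V] [Module L V] [AddCommGroup W] [Module k W]
  {ρ : Representation k G W} {τ : Representation L G V}

@[simp]
lemma repBaseChange_tmul (g : G) (a : L) (w : W) :
    repBaseChange L ρ g (a ⊗ₜ w) = a ⊗ₜ ρ g w := rfl

lemma exists_functional_ne_zero {x : L ⊗[k] W} (hx : x ≠ 0) :
    ∃ φ : L →ₗ[k] k, TensorProduct.lid k W (φ.rTensor W x) ≠ 0 := by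
  classical
  let b := Module.Basis.ofVectorSpace k L
  by_contra! h
  apply hx
  apply (TensorProduct.equivFinsuppOfBasisLeft b).injective
  rw [map_zero]
  ext i
  have : ∀ y : L ⊗[k] W, TensorProduct.equivFinsuppOfBasisLeft b y i =
      TensorProduct.lid k W ((b.coord i).rTensor W y) := by
    intro y
    induction y using TensorProduct.induction_on with
    | zero => simp
    | tmul a w => simp
    | add y z hy hz => simp [hy, hz]
  rw [this, h, Finsupp.zero_apply]

lemma exists_addHom_of_injective (i : IntertwiningMap τ (repBaseChange L ρ))
    (hi : Function.Injective i) {v : V} (hv : v ≠ 0) :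
    ∃ f : V →+ W, (∀ g x, f (τ g x) = ρ g (f x)) ∧ f v ≠ 0 := by
  have hiv : i v ≠ 0 := fun h ↦ hv (hi (h.trans (map_zero i).symm))
  obtain ⟨φ, hφ⟩ := exists_functional_ne_zero hiv
  refine ⟨((TensorProduct.lid k W).toLinearMap ∘ₗ φ.rTensor W).toAddMonoidHom.comp
    i.toLinearMap.toAddMonoidHom, fun g x ↦ ?_, hφ⟩
  have key : ∀ y : L ⊗[k] W, TensorProduct.lid k W (φ.rTensor W (repBaseChange L ρ g y)) =
      ρ g (TensorProduct.lid k W (φ.rTensor W y)) := by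
    intro y
    induction y using TensorProduct.induction_on with
    | zero => simp
    | tmul a w => simp
    | add y z hy hz => simp only [map_add, hy, hz]
  change TensorProduct.lid k W (φ.rTensor W (i (τ g x))) = _
  rw [i.isIntertwining, key]
  rfl

lemma exists_ne_zero_of_surjective [Nontrivial V] (r : IntertwiningMap (repBaseChange L ρ) τ)
    (hr : Function.Surjective r) : ∃ w : W, r (1 ⊗ₜ w) ≠ 0 := by
  by_contra! h
  obtain ⟨v, hv⟩ := exists_ne (0 : V)
  obtain ⟨x, rfl⟩ := hr v
  refine hv ?_
  clear hv
  induction x using TensorProduct.induction_on with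
  | zero => exact map_zero r
  | tmul a w =>
    have : (a ⊗ₜ[k] w : L ⊗[k] W) = a • (1 ⊗ₜ w) := by simp [TensorProduct.smul_tmul']
    rw [this, map_smul, h, smul_zero]
  | add y z hy hz => rw [map_add, hy, hz, add_zero]

end BaseChange

section Uniqueness

/-- Two simple representations over `𝔽_p` are isomorphic as soon as some representation `σ`
over an extension field is a quotient of a scalar extension of the first and embeds in a scalar
extension of the second, after a further scalar extension. -/
lemma nonempty_equiv_of_common_component {p : ℕ} [Fact p.Prime] {G : Type*} [Monoid G]
    {K₁ K₂ L : Type*} [Field K₁] [Field K₂] [Field L] [Algebra (ZMod p) K₁] [Algebra (ZMod p) K₂]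
    [Algebra K₁ L] [Algebra K₂ L]
    {W₁ W₂ V₁ V₂ X : Type*} [AddCommGroup W₁] [Module (ZMod p) W₁]
    [AddCommGroup W₂] [Module (ZMod p) W₂] [AddCommGroup V₁] [Module K₁ V₁] [Nontrivial V₁]
    [AddCommGroup V₂] [Module K₂ V₂] [AddCommGroup X] [Module L X]
    {ρ₁ : Representation (ZMod p) G W₁} {ρ₂ : Representation (ZMod p) G W₂}
    {τ₁ : Representation K₁ G V₁} {τ₂ : Representation K₂ G V₂} {σ : Representation L G X}
    [IsIrreducible ρ₁] [IsIrreducible ρ₂]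
    (r₁ : IntertwiningMap (repBaseChange K₁ ρ₁) τ₁) (hr₁ : Function.Surjective r₁)
    (i₂ : IntertwiningMap τ₂ (repBaseChange K₂ ρ₂)) (hi₂ : Function.Injective i₂)
    (e₁ : (repBaseChange L τ₁).Equiv σ) (e₂ : (repBaseChange L τ₂).Equiv σ) :
    Nonempty (ρ₁.Equiv ρ₂) := by
  obtain ⟨w, hw⟩ := exists_ne_zero_of_surjective r₁ hr₁
  have hx : e₁ (1 ⊗ₜ r₁ (1 ⊗ₜ w)) ≠ 0 := by
    intro h
    have h' : (1 : L) ⊗ₜ[K₁] r₁ (1 ⊗ₜ w) = 0 := e₁.toLinearEquiv.map_eq_zero_iff.mp h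
    exact hw ((Module.FaithfullyFlat.one_tmul_eq_zero_iff K₁ V₁ _).mp h')
  obtain ⟨f, hf, hfx⟩ := exists_addHom_of_injective e₂.symm.toIntertwiningMap
    e₂.symm.toLinearEquiv.injective hx
  obtain ⟨f', hf', hfx'⟩ := exists_addHom_of_injective i₂ hi₂ hfx
  let φ : W₁ →+ W₂ :=
    { toFun := fun w ↦ f' (f (e₁ (1 ⊗ₜ r₁ (1 ⊗ₜ w))))
      map_zero' := by simp
      map_add' := by intro x y; simp [TensorProduct.tmul_add] }
  let Φ : IntertwiningMap ρ₁ ρ₂ :=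
    (φ.toZModLinearMap p).intertwiningMap_of_isIntertwiningMap ρ₁ ρ₂ fun g v ↦ by
      change f' (f (e₁ (1 ⊗ₜ r₁ (1 ⊗ₜ ρ₁ g v)))) = ρ₂ g (f' (f (e₁ (1 ⊗ₜ r₁ (1 ⊗ₜ v)))))
      have he₁ : ∀ y, e₁ (repBaseChange L τ₁ g y) = σ g (e₁ y) :=
        fun y ↦ IntertwiningMap.isIntertwining _ _ e₁.toIntertwiningMap g y
      rw [← hf', ← hf, ← he₁, repBaseChange_tmul, ← r₁.isIntertwining,
        repBaseChange_tmul]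
  refine (Representation.IsIrreducible.bijective_or_eq_zero Φ).elim
    (fun h ↦ ⟨Φ.ofBijective h⟩) fun h ↦ (hfx' ?_).elim
  exact DFunLike.congr_fun h w

end Uniqueness

section Existence

lemma isIrreducible_of_repBaseChange {k L G V X : Type*} [Field k] [Field L] [Algebra k L]
    [Monoid G] [AddCommGroup V] [Module k V] [AddCommGroup X] [Module L X]
    {ρ : Representation k G V} {σ : Representation L G X} [IsIrreducible σ]
    (e : (repBaseChange L ρ).Equiv σ) : IsIrreducible ρ where
  exists_pair_ne := by
    refine ⟨⊥, ⊤, fun h ↦ ?_⟩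
    have hV : ∀ v : V, v = 0 := fun v ↦
      (show v ∈ (⊥ : Subrepresentation ρ).toSubmodule from h ▸ Submodule.mem_top)
    have : Subsingleton V := ⟨fun v w ↦ (hV v).trans (hV w).symm⟩
    have hX : Subsingleton X := e.toLinearEquiv.symm.injective.subsingleton
    obtain ⟨A, B, hAB⟩ := exists_pair_ne (Subrepresentation σ)
    exact hAB (Subrepresentation.toSubmodule_injective (Subsingleton.elim _ _))
  eq_bot_or_eq_top U := by
    let j : IntertwiningMap (repBaseChange L U.toRepresentation) σ :=
      (e.toLinearMap ∘ₗ U.toSubmodule.subtype.baseChange L).intertwiningMap_of_isIntertwiningMap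
        _ _ fun g x ↦ by
        change e (U.toSubmodule.subtype.baseChange L (repBaseChange L U.toRepresentation g x)) =
          σ g (e (U.toSubmodule.subtype.baseChange L x))
        have h : U.toSubmodule.subtype.baseChange L (repBaseChange L U.toRepresentation g x) =
            repBaseChange L ρ g (U.toSubmodule.subtype.baseChange L x) := by
          induction x using TensorProduct.induction_on with
          | zero => simp
          | tmul a w => rfl
          | add y z hy hz => simp only [map_add, hy, hz]
        rw [h]
        exact IntertwiningMap.isIntertwining _ _ e.toIntertwiningMap g _
    rcases Representation.IsIrreducible.surjective_or_eq_zero j with h | h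
    · right
      have h' : Function.Surjective (U.toSubmodule.subtype.lTensor L) := by
        intro y
        obtain ⟨x, hx⟩ := h (e y)
        exact ⟨x, e.toLinearEquiv.injective hx⟩
      rw [Module.FaithfullyFlat.lTensor_surjective_iff_surjective] at h'
      apply Subrepresentation.toSubmodule_injective
      rw [← Submodule.range_subtype U.toSubmodule, LinearMap.range_eq_top.mpr h']
      rfl
    · left
      apply Subrepresentation.toSubmodule_injective
      refine (Submodule.eq_bot_iff _).mpr fun v hv ↦ ?_
      have h' : e ((1 : L) ⊗ₜ v) = 0 :=
        DFunLike.congr_fun h ((1 : L) ⊗ₜ (⟨v, hv⟩ : U.toSubmodule))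
      exact (Module.FaithfullyFlat.one_tmul_eq_zero_iff k V v).mp
        (e.toLinearEquiv.map_eq_zero_iff.mp h')

lemma isIrreducible_of_isAtom {k G V : Type*} [Field k] [Monoid G] [AddCommGroup V]
    [Module k V] {ρ : Representation k G V} {U : Subrepresentation ρ} (hU : IsAtom U) :
    IsIrreducible U.toRepresentation where
  exists_pair_ne := by
    refine ⟨⊥, ⊤, fun h ↦ hU.1 (Subrepresentation.toSubmodule_injective ?_)⟩
    refine (Submodule.eq_bot_iff _).mpr fun v hv ↦ ?_
    have : (⟨v, hv⟩ : U.toSubmodule) ∈ (⊥ : Subrepresentation U.toRepresentation).toSubmodule :=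
      h ▸ Submodule.mem_top
    exact congrArg Subtype.val ((Submodule.mem_bot k).mp this)
  eq_bot_or_eq_top T := by
    let T' : Subrepresentation ρ :=
      { toSubmodule := T.toSubmodule.map U.toSubmodule.subtype
        apply_mem_toSubmodule := by
          rintro g _ ⟨v, hv, rfl⟩
          exact ⟨U.toRepresentation g v, T.apply_mem_toSubmodule g hv, rfl⟩ }
    have hT' : T' ≤ U := by
      rintro _ ⟨v, -, rfl⟩
      exact v.2
    refine (hU.le_iff.mp hT').imp (fun h ↦ ?_) (fun h ↦ ?_) <;>
      apply Subrepresentation.toSubmodule_injective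
    · refine Submodule.map_injective_of_injective U.toSubmodule.injective_subtype ?_
      exact (congrArg Subrepresentation.toSubmodule h).trans (Submodule.map_bot _).symm
    · refine Submodule.map_injective_of_injective U.toSubmodule.injective_subtype ?_
      refine (congrArg Subrepresentation.toSubmodule h).trans ?_
      exact (Submodule.map_subtype_top U.toSubmodule).symm

lemma exists_irreducible_subrepresentation {k G V : Type*} [Field k] [Monoid G] [AddCommGroup V]
    [Module k V] [Finite V] [Nontrivial V] (ρ : Representation k G V) :
    ∃ U : Subrepresentation ρ, IsIrreducible U.toRepresentation := by
  have : Finite (Subrepresentation ρ) :=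
    Finite.of_injective _ (SetLike.coe_injective (A := Subrepresentation ρ))
  obtain h | ⟨U, hU, -⟩ := eq_bot_or_exists_atom_le (⊤ : Subrepresentation ρ)
  · exact absurd (congrArg Subrepresentation.toSubmodule h.symm) bot_ne_top
  · exact ⟨U, isIrreducible_of_isAtom hU⟩

/-- The map `w ↦ a ⊗ w` from a representation to the restriction of its scalar extension. -/
noncomputable def tmulIntertwiningMap {k K G W : Type*} [Field k] [Field K] [Algebra k K] [Monoid G]
    [AddCommGroup W] [Module k W] (ρ : Representation k G W) (a : K) :
    IntertwiningMap ρ (repRes k (repBaseChange K ρ)) :=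
  (TensorProduct.mk k K W a).intertwiningMap_of_isIntertwiningMap _ _ fun _ _ ↦ rfl

/-- A surjection from a representation that is a sum of images of an irreducible one splits. -/
lemma exists_section_of_iSup_range_eq_top {k G W M N ι : Type*} [Field k] [Monoid G]
    [AddCommGroup W] [Module k W] [AddCommGroup M] [Module k M] [AddCommGroup N] [Module k N]
    {ρ : Representation k G W} {μ : Representation k G M} {ν : Representation k G N}
    [IsIrreducible ρ] (f : ι → IntertwiningMap ρ μ)
    (hf : ⨆ i, LinearMap.range (f i).toLinearMap = ⊤) (q : IntertwiningMap μ ν)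
    (hq : Function.Surjective q) : ∃ s : IntertwiningMap ν μ, ∀ v, q (s v) = v := by
  let f' (i : ι) := IntertwiningMap.equivLinearMapAsModule ρ μ (f i)
  have : IsSemisimpleModule (MonoidAlgebra k G) μ.asModule := by
    refine isSemisimpleModule_of_isSemisimpleModule_submodule'
      (p := fun i ↦ LinearMap.range (f' i)) (fun i ↦ IsSemisimpleModule.range _) ?_
    rw [eq_top_iff]
    suffices h : ∀ x : M, x ∈ ⨆ i, LinearMap.range (f i).toLinearMap →
        μ.asModuleEquiv.symm x ∈ ⨆ i, LinearMap.range (f' i) from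
      fun x _ ↦ h (μ.asModuleEquiv x) (hf ▸ Submodule.mem_top)
    intro x hx
    induction hx using Submodule.iSup_induction' with
    | mem i x hx =>
      obtain ⟨w, rfl⟩ := hx
      exact Submodule.mem_iSup_of_mem i ⟨w, rfl⟩
    | zero => exact Submodule.zero_mem _
    | add y z _ _ hy hz => exact Submodule.add_mem _ hy hz
  obtain ⟨s, hs⟩ := IsSemisimpleModule.lifting_property
    (IntertwiningMap.equivLinearMapAsModule μ ν q) hq LinearMap.id
  exact ⟨(IntertwiningMap.equivLinearMapAsModule ν μ).symm s, DFunLike.congr_fun hs⟩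

lemma exists_equivariant_section {k K G V W : Type*} [Field k] [Field K] [Algebra k K] [Monoid G]
    [AddCommGroup V] [Module k V] [Module K V] [IsScalarTower k K V]
    [AddCommGroup W] [Module k W] {ρ : Representation k G W} [IsIrreducible ρ]
    {τ : Representation K G V} (q : IntertwiningMap (repBaseChange K ρ) τ)
    (hq : Function.Surjective q) :
    ∃ s : V →ₗ[k] K ⊗[k] W, (∀ g v, s (τ g v) = repBaseChange K ρ g (s v)) ∧
      ∀ v, q (s v) = v := by
  let q' : IntertwiningMap (repRes k (repBaseChange K ρ)) (repRes k τ) :=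
    (q.toLinearMap.restrictScalars k).intertwiningMap_of_isIntertwiningMap _ _ q.isIntertwining
  obtain ⟨s, hs⟩ := exists_section_of_iSup_range_eq_top (tmulIntertwiningMap (K := K) ρ) (by
    rw [eq_top_iff]
    intro x _
    induction x using TensorProduct.induction_on with
    | zero => exact Submodule.zero_mem _
    | tmul a w => exact Submodule.mem_iSup_of_mem a ⟨w, rfl⟩
    | add y z hy hz => exact Submodule.add_mem _ (hy trivial) (hz trivial)) q' hq
  exact ⟨s.toLinearMap, fun g ↦ LinearMap.congr_fun (s.isIntertwining' g), hs⟩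

open Algebra.FormallyUnramified in
lemma sec_naturality {R S M N : Type*} [CommRing R] [CommRing S] [Algebra R S]
    [Algebra.FormallyUnramified R S] [Algebra.EssFiniteType R S]
    [AddCommGroup M] [Module R M] [Module S M] [IsScalarTower R S M]
    [AddCommGroup N] [Module R N] [Module S N] [IsScalarTower R S N] (f : M →ₗ[S] N) (m : M) :
    sec R S N (f m) = (f.restrictScalars R).baseChange S (sec R S M m) := by
  change TensorProduct.AlgebraTensorModule.map (LinearMap.id (R := S) (M := S))
      ((Algebra.lsmul R R N).toLinearMap.flip (f m)) (elem R S) =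
    (f.restrictScalars R).baseChange S (TensorProduct.AlgebraTensorModule.map
      (LinearMap.id (R := S) (M := S)) ((Algebra.lsmul R R M).toLinearMap.flip m) (elem R S))
  induction elem R S using TensorProduct.induction_on with
  | zero => simp
  | tmul a b => simp
  | add y z hy hz => simp only [map_add, hy, hz]

lemma exists_linear_equivariant_section {k K G V M : Type*} [Field k] [Field K] [Algebra k K]
    [FiniteDimensional k K] [Algebra.IsSeparable k K] [Monoid G]
    [AddCommGroup V] [Module k V] [Module K V] [IsScalarTower k K V]
    [AddCommGroup M] [Module k M] [Module K M] [IsScalarTower k K M]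
    {μ : Representation K G M} {τ : Representation K G V} (q : IntertwiningMap μ τ)
    (s : V →ₗ[k] M) (hs : ∀ g v, s (τ g v) = μ g (s v)) (hqs : ∀ v, q (s v) = v) :
    ∃ i : IntertwiningMap τ μ, ∀ v, q (i v) = v := by
  have := Algebra.FormallyUnramified.of_isSeparable k K
  refine ⟨(s.liftBaseChange K ∘ₗ Algebra.FormallyUnramified.sec k K V
    ).intertwiningMap_of_isIntertwiningMap _ _ fun g v ↦ ?_, fun v ↦ ?_⟩
  · rw [LinearMap.comp_apply, LinearMap.comp_apply, sec_naturality]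
    induction Algebra.FormallyUnramified.sec k K V v using TensorProduct.induction_on with
    | zero => simp
    | tmul a b => simp [hs]
    | add y z hy hz => simp only [map_add, hy, hz]
  · conv_rhs => rw [← LinearMap.id_apply (R := K) v,
      ← Algebra.FormallyUnramified.comp_sec k K V]
    change q (s.liftBaseChange K (Algebra.FormallyUnramified.sec k K V v)) = _
    rw [LinearMap.comp_apply]
    induction Algebra.FormallyUnramified.sec k K V v using TensorProduct.induction_on with
    | zero => simp
    | tmul a b => simp [hqs]
    | add y z hy hz => simp only [map_add, hy, hz]

lemma exists_repSummand_of_irreducible {k K G V : Type*} [Field k] [Field K] [Algebra k K]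
    [Finite K] [Algebra.IsSeparable k K] [Monoid G]
    [AddCommGroup V] [Finite V] [Module k V] [Module K V] [IsScalarTower k K V]
    (τ : Representation K G V) [IsIrreducible τ] :
    ∃ (U : Submodule k V) (ρ : Representation k G U), IsIrreducible ρ ∧
      RepSummand τ (repBaseChange K ρ) := by
  have : Nontrivial V := (IsSimpleModule.nontrivial (MonoidAlgebra K G) τ.asModule :)
  obtain ⟨U, hU⟩ := exists_irreducible_subrepresentation (repRes k τ)
  let q : IntertwiningMap (repBaseChange K U.toRepresentation) τ :=
    (U.toSubmodule.subtype.liftBaseChange K).intertwiningMap_of_isIntertwiningMap _ _ fun g x ↦ by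
      induction x using TensorProduct.induction_on with
      | zero => simp
      | tmul a w =>
        rw [repBaseChange_tmul, LinearMap.liftBaseChange_tmul, LinearMap.liftBaseChange_tmul,
          map_smul]
        rfl
      | add y z hy hz => simp only [map_add, hy, hz]
  have hq : Function.Surjective q := by
    refine (Representation.IsIrreducible.surjective_or_eq_zero q).resolve_right fun h ↦ ?_
    have : Nontrivial U.toSubmodule :=
      (IsSimpleModule.nontrivial (MonoidAlgebra k G) U.toRepresentation.asModule :)
    obtain ⟨u, hu⟩ := exists_ne (0 : U.toSubmodule)
    have h' : U.toSubmodule.subtype.liftBaseChange K (1 ⊗ₜ u) = 0 := DFunLike.congr_fun h _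
    rw [LinearMap.liftBaseChange_tmul, one_smul] at h'
    exact hu (Subtype.ext h')
  obtain ⟨s, hs, hqs⟩ := exists_equivariant_section q hq
  obtain ⟨i, hi⟩ := exists_linear_equivariant_section q s hs hqs
  exact ⟨U.toSubmodule, U.toRepresentation, hU, repSummand_iff.mpr ⟨i, q, hi⟩⟩

lemma exists_finite_field_of_definition {F L G X : Type*} [Field F] [Finite F] [Field L]
    [Algebra F L] [Algebra.IsAlgebraic F L] [Monoid G] [Finite G] [AddCommGroup X] [Module L X]
    [FiniteDimensional L X] (σ : Representation L G X) :
    ∃ K : IntermediateField F L, Finite K ∧ ∃ (n : ℕ) (τ : Representation K G (Fin n → K)),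
      Nonempty ((repBaseChange L τ).Equiv σ) := by
  let b := Module.finBasis L X
  let n := Module.finrank L X
  let A (g : G) : Matrix (Fin n) (Fin n) L := LinearMap.toMatrix b b (σ g)
  let S : Set L := Set.range fun x : G × Fin n × Fin n ↦ A x.1 x.2.1 x.2.2
  let K := IntermediateField.adjoin F S
  have : FiniteDimensional F K := IntermediateField.finiteDimensional_adjoin
    fun x _ ↦ Algebra.IsIntegral.isIntegral x
  have hK : Finite K := Module.finite_of_finite F
  let B (g : G) : Matrix (Fin n) (Fin n) K := fun i j ↦
    ⟨A g i j, IntermediateField.subset_adjoin F S ⟨(g, i, j), rfl⟩⟩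
  have hB : ∀ g, (B g).map (algebraMap K L) = A g := fun g ↦ rfl
  have hinj : Function.Injective fun M : Matrix (Fin n) (Fin n) K ↦ M.map (algebraMap K L) :=
    Matrix.map_injective (algebraMap K L).injective
  let τ : Representation K G (Fin n → K) :=
    { toFun := fun g ↦ Matrix.toLin' (B g)
      map_one' := by
        rw [show B 1 = 1 from hinj ((hB 1).trans (.trans (by
          simp [A, Module.End.one_eq_id])
          (Matrix.map_one _ (map_zero (algebraMap K L)) (map_one _)).symm))]
        exact Matrix.toLin'_one
      map_mul' := fun g h ↦ by
        rw [show B (g * h) = B g * B h from hinj (by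
          simp [hB, A, Matrix.map_mul, Module.End.mul_eq_comp, LinearMap.toMatrix_comp b b b])]
        exact Matrix.toLin'_mul _ _ }
  refine ⟨K, hK, n, τ, ⟨.mk ((TensorProduct.piScalarRight K L L (Fin n)).trans b.equivFun.symm)
    fun g ↦ ?_⟩⟩
  ext j
  let P := TensorProduct.piScalarRight K L L (Fin n)
  have hP : ∀ v : Fin n → K, P (1 ⊗ₜ v) = fun i ↦ algebraMap K L (v i) := fun v ↦ by
    ext i
    simp [P, Algebra.smul_def]
  change b.equivFun.symm (P (1 ⊗ₜ Matrix.toLin' (B g) (Pi.single j 1))) =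
    σ g (b.equivFun.symm (P (1 ⊗ₜ Pi.single j 1)))
  have hj : b.equivFun.symm (P (1 ⊗ₜ Pi.single j 1)) = b j := by
    rw [hP, LinearEquiv.symm_apply_eq]
    ext i
    simp [Pi.single_apply, eq_comm, apply_ite]
  rw [hj, hP, LinearEquiv.symm_apply_eq]
  ext i
  rw [Matrix.toLin'_apply, Matrix.mulVec_single_one]
  exact LinearMap.toMatrix_apply b b (σ g) i j

end Existence

/-- Totality and well-definedness of the map `Σ : ITS(F̄G) → ITS(FG)` for a finite-dimensional
simple `F̄G`-module `X` : (i) `X` arises as `V ⊗_K F̄` for a simple `KG`-component `V` of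
`W ⊗_F K`, with `K` a finite subfield of `F̄` and `W` a simple `FG`-module; (ii) the simple
`FG`-module `W` is determined by `X` up to isomorphism. -/
theorem sigma_total_and_wellDefined (p : ℕ) [Fact p.Prime]
    (G : Type) [Group G] [Finite G]
    (X : FDRep (AlgebraicClosure (ZMod p)) G) (hX : RepSimple X.ρ) :
    (∃ K : IntermediateField (ZMod p) (AlgebraicClosure (ZMod p)), Finite ↥K ∧
      ∃ W : FDRep (ZMod p) G, RepSimple W.ρ ∧
        ∃ V : FDRep ↥K G, RepSimple V.ρ ∧
          RepSummand V.ρ (repBaseChange ↥K W.ρ) ∧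
          RepIso (repBaseChange (AlgebraicClosure (ZMod p)) V.ρ) X.ρ) ∧
    (∀ (K₁ K₂ : IntermediateField (ZMod p) (AlgebraicClosure (ZMod p))),
      Finite ↥K₁ → Finite ↥K₂ →
      ∀ (W₁ W₂ : FDRep (ZMod p) G), RepSimple W₁.ρ → RepSimple W₂.ρ →
      ∀ (V₁ : FDRep ↥K₁ G) (V₂ : FDRep ↥K₂ G),
        RepIndecomposable V₁.ρ → RepIndecomposable V₂.ρ →
        RepSummand V₁.ρ (repBaseChange ↥K₁ W₁.ρ) →
        RepSummand V₂.ρ (repBaseChange ↥K₂ W₂.ρ) →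
        RepIso (repBaseChange (AlgebraicClosure (ZMod p)) V₁.ρ) X.ρ →
        RepIso (repBaseChange (AlgebraicClosure (ZMod p)) V₂.ρ) X.ρ →
        RepIso W₁.ρ W₂.ρ) := by

  constructor
  · have := repSimple_iff.mp hX
    obtain ⟨K, hK, n, τ, ⟨e⟩⟩ := exists_finite_field_of_definition (F := ZMod p) X.ρ
    have hτ : IsIrreducible τ := isIrreducible_of_repBaseChange e
    obtain ⟨U, ρ, hρ, hsum⟩ := exists_repSummand_of_irreducible (k := ZMod p) τ
    exact ⟨K, hK, FDRep.of ρ, repSimple_iff.mpr hρ, FDRep.of τ, repSimple_iff.mpr hτ, hsum,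
      repIso_iff.mpr ⟨e⟩⟩
  · intro K₁ K₂ _ _ W₁ W₂ hW₁ hW₂ V₁ V₂ hV₁ _ h₁ h₂ hX₁ hX₂
    have := repSimple_iff.mp hW₁
    have := repSimple_iff.mp hW₂
    have := hV₁.1
    obtain ⟨i₁, r₁, h₁⟩ := repSummand_iff.mp h₁
    obtain ⟨i₂, r₂, h₂⟩ := repSummand_iff.mp h₂
    obtain ⟨e₁⟩ := repIso_iff.mp hX₁
    obtain ⟨e₂⟩ := repIso_iff.mp hX₂
    exact repIso_iff.mpr (nonempty_equiv_of_common_component r₁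
      (Function.RightInverse.surjective h₁) i₂ (Function.LeftInverse.injective h₂) e₁ e₂)
end
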